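/- Let k ⊆ K ⊆ E ⊆ L be field extensions with [L:K] < ∞. If E is separable over K, then ed_k(E/K) ≤ ed_k(L/K). -/

import Mathlib

open scoped TensorProduct

universe u

/-- The transcendence degree of `E` over `k`, as a cardinal: the supremum of the cardinalities
of algebraically independent subsets of `E`. -/
noncomputable def trdeg (k E : Type u) [CommRing k] [CommRing E] [Algebra k E] : Cardinal :=
  ⨆ s : {s : Set E // AlgebraicIndependent k ((↑) : s → E)}, Cardinal.mk s.1

/-- The `K`-algebra `A` descends to the intermediate field `K₀` of `K/k`: there is a
`K₀`-algebra `A₀` with `A ≅ A₀ ⊗_{K₀} K` as `K`-algebras. -/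
def Descends (k : Type u) {K : Type u} (A : Type u) [Field k] [Field K] [Algebra k K]
    [Ring A] [Algebra K A] (K₀ : IntermediateField k K) : Prop :=
  ∃ (A₀ : Type u) (_ : Ring A₀) (_ : Algebra K₀ A₀),
    Nonempty ((K ⊗[K₀] A₀) ≃ₐ[K] A)

/-- The essential dimension `ed k K A` of a `K`-algebra `A` over the base field `k ⊆ K`:
the minimum of `trdeg k K₀` over all intermediate fields `k ⊆ K₀ ⊆ K` to which `A`
descends. -/
noncomputable def ed (k K A : Type u) [Field k] [Field K] [Algebra k K]
    [Ring A] [Algebra K A] : Cardinal :=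
  ⨅ K₀ : {K₀ : IntermediateField k K // Descends k A K₀}, trdeg k K₀.1
section Descent

open Polynomial IntermediateField

theorem descends_top (k K A : Type u) [Field k] [Field K] [Algebra k K]
    [Ring A] [Algebra K A] : Descends k A (⊤ : IntermediateField k K) := by
  refine ⟨A, inferInstance, inferInstance, ⟨?_⟩⟩
  let i : A →ₐ[K] K ⊗[(⊤ : IntermediateField k K)] A :=
    { (Algebra.TensorProduct.includeRight :
        A →ₐ[(⊤ : IntermediateField k K)] K ⊗[(⊤ : IntermediateField k K)] A) with
      commutes' := fun r => by
        have h : (algebraMap K A r) =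
          algebraMap (⊤ : IntermediateField k K) A ⟨r, IntermediateField.mem_top⟩ := rfl
        change (1 : K) ⊗ₜ[(⊤ : IntermediateField k K)] algebraMap K A r = _
        rw [h, Algebra.algebraMap_eq_smul_one, ← TensorProduct.smul_tmul,
          Algebra.TensorProduct.algebraMap_apply]
        congr 1
        simp [Algebra.smul_def] }
  let f : K ⊗[(⊤ : IntermediateField k K)] A →ₐ[K] A :=
    Algebra.TensorProduct.lift (Algebra.ofId K A) (AlgHom.id (⊤ : IntermediateField k K) A)
      (fun r x => Algebra.commutes r x)
  have hf : ∀ x : A, f (1 ⊗ₜ x) = x := fun x =>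
    (Algebra.TensorProduct.lift_tmul _ _ _ 1 x).trans (by simp)
  exact AlgEquiv.ofAlgHom f i
    (AlgHom.ext hf) (Algebra.TensorProduct.ext (by ext) (AlgHom.ext fun x =>
      congrArg (fun y : A => (1 : K) ⊗ₜ[(⊤ : IntermediateField k K)] y) (hf x)))

theorem Descends.congr {k K A B : Type u} [Field k] [Field K] [Algebra k K]
    [Ring A] [Algebra K A] [Ring B] [Algebra K B] {K₀ : IntermediateField k K}
    (h : Descends k A K₀) (e : A ≃ₐ[K] B) : Descends k B K₀ := by
  obtain ⟨A₀, i, j, ⟨f⟩⟩ := h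
  exact ⟨A₀, i, j, ⟨f.trans e⟩⟩

section

variable {F K L : Type*} [Field F] [Field K] [Field L] [Algebra F K] [Algebra F L]
  [Algebra K L] [IsScalarTower F K L]

/-- The coefficients of a minimal polynomial over an intermediate field `K` of `L / F` are integral
over `F`, if the element itself is. -/
theorem isIntegral_coeff_minpoly {b : L} (hb : IsIntegral F b) (n : ℕ) :
    IsIntegral F ((minpoly K b).coeff n) := by
  have h := integralClosure.mem_lifts_of_monic_of_dvd_map K (minpoly.monic hb)
    (minpoly.monic (hb.tower_top (A := K))) (minpoly.dvd_map_of_isScalarTower F K b)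
  obtain ⟨y, hy⟩ := (lifts_iff_coeff_lifts _).1 h n
  rw [← hy]
  exact y.2

theorem minpoly_eq_map_of_integrallyClosedIn
    (hF : ∀ x : K, IsIntegral F x → x ∈ (algebraMap F K).range) {b : L} (hb : IsIntegral F b) :
    minpoly K b = (minpoly F b).map (algebraMap F K) := by
  obtain ⟨p, hp, hdeg, hmonic⟩ := lifts_and_degree_eq_and_monic
    ((lifts_iff_coeff_lifts (f := algebraMap F K) (minpoly K b)).2
      fun n => hF _ (isIntegral_coeff_minpoly hb n)) (minpoly.monic (hb.tower_top (A := K)))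
  have hroot : aeval b p = 0 := by
    rw [← aeval_map_algebraMap K, hp, minpoly.aeval]
  refine (eq_of_monic_of_associated (minpoly.monic hb.tower_top)
    ((minpoly.monic hb).map _) (associated_of_dvd_dvd
      (minpoly.dvd_map_of_isScalarTower F K b) ?_))
  rw [← hp]
  exact Polynomial.map_dvd _ (minpoly.dvd F b hroot)

/-- A finite extension generated by elements separable over a subfield `F` of the base has a
primitive element which is separable over `F`. -/
theorem exists_isSeparable_adjoin_simple_eq [FiniteDimensional K L] (S : Set L)
    (hS : ∀ x ∈ S, IsSeparable F x) : ∃ b : L, IsSeparable F b ∧ K⟮b⟯ = adjoin K S := by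
  obtain ⟨T, hTS, hT⟩ : ∃ T : Finset L, (T : Set L) ⊆ S ∧ adjoin K (T : Set L) = adjoin K S := by
    obtain ⟨t, ht⟩ := fg_of_noetherian (adjoin K S)
    have hmem : ∀ x : t, ∃ T : Finset L, (T : Set L) ⊆ S ∧ (x : L) ∈ adjoin K (T : Set L) :=
      fun x => exists_finset_of_mem_adjoin (ht ▸ subset_adjoin K _ x.2)
    classical
    choose T hTS hT using hmem
    refine ⟨Finset.univ.biUnion T, by simpa using hTS,
      le_antisymm (adjoin.mono _ _ _ (by simpa using hTS)) ?_⟩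
    rw [← ht, adjoin_le_iff]
    intro x hx
    exact adjoin.mono K _ _ (by
      exact_mod_cast Finset.subset_biUnion_of_mem T (Finset.mem_univ (⟨x, hx⟩ : t))) (hT ⟨x, hx⟩)
  have hsep : Algebra.IsSeparable F (adjoin F (T : Set L)) :=
    (isSeparable_adjoin_iff_isSeparable F L).2 fun x hx => hS x (hTS hx)
  have hfin : FiniteDimensional F (adjoin F (T : Set L)) :=
    finiteDimensional_adjoin fun x hx => (hS x (hTS hx)).isIntegral
  obtain ⟨c, hc⟩ := Field.exists_primitive_element F (adjoin F (T : Set L))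
  refine ⟨c, (Algebra.IsSeparable.isSeparable F c).map
    (adjoin F (T : Set L)).val Subtype.val_injective, ?_⟩
  have hc' : F⟮(c : L)⟯ = adjoin F (T : Set L) := by
    have := congrArg lift hc
    simpa using this
  have hle : adjoin F (T : Set L) ≤ (adjoin K (T : Set L)).restrictScalars F :=
    adjoin_le_iff.2 (subset_adjoin K _)
  have hle' : F⟮(c : L)⟯ ≤ K⟮(c : L)⟯.restrictScalars F :=
    adjoin_le_iff.2 (subset_adjoin K _)
  rw [← hT]
  refine le_antisymm (adjoin_le_iff.2 (by simpa using hle c.2)) (adjoin_le_iff.2 fun x hx => ?_)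
  exact hle' (hc'.ge (subset_adjoin F _ hx))

theorem IsIntegral.exists_isSeparable_pow {F L : Type*} [Field F] [Field L] [Algebra F L]
    (q : ℕ) [ExpChar F q] {x : L} (hx : IsIntegral F x) : ∃ n : ℕ, IsSeparable F (x ^ q ^ n) := by
  obtain ⟨g, h1, n, h2⟩ := (minpoly.irreducible hx).hasSeparableContraction q
  refine ⟨n, h1.of_dvd <| minpoly.dvd F _ ?_⟩
  simpa only [expand_aeval, minpoly.aeval] using congr_arg (aeval x) h2

omit [IsScalarTower F K L] in
/-- If `L / K` is generated by elements algebraic over `F`, then every separable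
intermediate extension lies in any subfield containing the elements separable over `F`. -/
theorem le_of_forall_isSeparable_mem
    (hL : adjoin K {x : L | IsIntegral F x} = ⊤) (E : IntermediateField K L)
    [Algebra.IsSeparable K E] (M : IntermediateField K L) (hM : ∀ x : L, IsSeparable F x → x ∈ M) :
    E ≤ M := by
  obtain ⟨q, hq⟩ := ExpChar.exists F
  have : ExpChar M q :=
    expChar_of_injective_ringHom ((algebraMap K M).comp (algebraMap F K)).injective q
  have hle : adjoin K {x : L | IsIntegral F x} ≤ (perfectClosure M L).restrictScalars K := by
    refine adjoin_le_iff.2 fun x (hx : IsIntegral F x) => ?_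
    obtain ⟨n, hn⟩ := hx.exists_isSeparable_pow q
    exact (mem_perfectClosure_iff_pow_mem q).2 ⟨n, ⟨x ^ q ^ n, hM _ hn⟩, rfl⟩
  have htop : perfectClosure M L = ⊤ :=
    top_unique fun x _ => hle (hL.ge (mem_top (x := x)))
  have hpi := isPurelyInseparable_iff_perfectClosure_eq_top.2 htop
  intro x hx
  have hs : IsSeparable K x :=
    mem_separableClosure_iff.1 (le_separableClosure K L E hx)
  obtain ⟨y, hy⟩ := hpi.inseparable' x (hs.tower_top M)
  rw [← hy]
  exact y.2

/-- An intermediate field of a simple extension generated by an element integral over `F`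
is generated by elements integral over `F`. -/
theorem adjoin_isIntegral_eq_of_primitive [FiniteDimensional K L] {b : L} (hb : IsIntegral F b)
    (hprim : K⟮b⟯ = ⊤) (E : IntermediateField K L) :
    adjoin K {x : E | IsIntegral F x} = ⊤ := by
  have : IsScalarTower F E L :=
    IsScalarTower.of_algebraMap_eq fun x => by
      rw [IsScalarTower.algebraMap_apply F K L, IsScalarTower.algebraMap_apply F K E]; rfl
  apply lift_injective
  rw [lift_top, lift_adjoin]
  refine le_antisymm (adjoin_le_iff.2 (by rintro _ ⟨x, -, rfl⟩; exact x.2)) ?_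
  conv_lhs => rw [← adjoin_minpoly_coeff_of_exists_primitive_element K hprim E]
  refine adjoin_le_iff.2 fun x hx => subset_adjoin K _ ?_
  obtain ⟨n, -, rfl⟩ := mem_coeffs_iff.1 (Finset.mem_coe.1 hx)
  exact ⟨(minpoly E b).coeff n, isIntegral_coeff_minpoly hb n, by simp⟩

end

/-- A separable extension generated by elements integral over `K₀`, where `K₀` is algebraically
closed in `K`, descends to `K₀`. -/
theorem descends_of_adjoin_eq_top {k K E : Type u} [Field k] [Field K] [Field E] [Algebra k K]
    [Algebra K E] [FiniteDimensional K E] [Algebra.IsSeparable K E] (K₀ : IntermediateField k K)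
    (hK₀ : ∀ x : K, IsIntegral K₀ x → x ∈ (algebraMap K₀ K).range)
    (hE : adjoin K {x : E | IsIntegral K₀ x} = ⊤) : Descends k E K₀ := by
  obtain ⟨c, hc, hcE⟩ := exists_isSeparable_adjoin_simple_eq (F := K₀) (K := K)
    {x : E | IsIntegral K₀ x} fun x hx => by
      have := Algebra.IsSeparable.isSeparable K x
      rwa [IsSeparable, minpoly_eq_map_of_integrallyClosedIn hK₀ hx, separable_map] at this
  rw [hE] at hcE
  have hint : IsIntegral K₀ c := hc.isIntegral
  refine ⟨K₀⟮c⟯, inferInstance, inferInstance, ⟨?_⟩⟩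
  have : FiniteDimensional K₀ K₀⟮c⟯ := adjoin.finiteDimensional hint
  let f : K ⊗[K₀] K₀⟮c⟯ →ₐ[K] E :=
    Algebra.TensorProduct.lift (Algebra.ofId K E) K₀⟮c⟯.val fun _ _ => Commute.all _ _
  have hsurj : Function.Surjective f := by
    rw [← AlgHom.range_eq_top, ← top_le_iff, ← top_toSubalgebra (F := K) (E := E), ← hcE,
      adjoin_simple_toSubalgebra_of_isAlgebraic hint.tower_top.isAlgebraic]
    refine Algebra.adjoin_le (Set.singleton_subset_iff.2 ⟨1 ⊗ₜ AdjoinSimple.gen K₀ c, ?_⟩)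
    simp [f]
  have : Module.Free K₀ K₀⟮c⟯ := Module.Free.of_divisionRing _ _
  have hrank : Module.finrank K (K ⊗[K₀] K₀⟮c⟯) = Module.finrank K E := by
    rw [Module.finrank_baseChange, adjoin.finrank hint, ← finrank_top' (F := K) (E := E), ← hcE,
      adjoin.finrank hint.tower_top, minpoly_eq_map_of_integrallyClosedIn hK₀ hint,
      natDegree_map]
  exact AlgEquiv.ofBijective f
    ⟨(LinearMap.injective_iff_surjective_of_finrank_eq_finrank (f := f.toLinearMap) hrank).2 hsurj,
      hsurj⟩

/-- If a finite extension `L / K` descends to `K₀`, it is generated by elements integral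
over `K₀`. -/
theorem Descends.adjoin_isIntegral_eq_top {k K L : Type u} [Field k] [Field K] [Field L]
    [Algebra k K] [Algebra K L] [FiniteDimensional K L] {K₀ : IntermediateField k K}
    (h : Descends k L K₀) : adjoin K {x : L | IsIntegral K₀ x} = ⊤ := by
  obtain ⟨A₀, _, _, ⟨e⟩⟩ := h
  have : Module.Finite K (K ⊗[K₀] A₀) := Module.Finite.equiv e.symm.toLinearEquiv
  have : Module.Finite K₀ A₀ := Module.Finite.of_finite_tensorProduct_of_faithfullyFlat K
  refine top_unique fun x _ => ?_
  obtain ⟨y, rfl⟩ := e.surjective x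
  induction y with
  | zero => simp
  | add a b ha hb => rw [map_add]; exact add_mem (ha trivial) (hb trivial)
  | tmul a b =>
    have hab : a ⊗ₜ[K₀] b = a • ((1 : K) ⊗ₜ[K₀] b) := by simp [TensorProduct.smul_tmul']
    rw [hab, map_smul]
    refine IntermediateField.smul_mem _ (subset_adjoin K _ ?_)
    exact (Algebra.IsIntegral.isIntegral (R := K₀) b).map
      ((e.toAlgHom.restrictScalars K₀).comp Algebra.TensorProduct.includeRight)

theorem isIntegral_of_intermediateField_le {k K L : Type*} [Field k] [Field K] [Field L]
    [Algebra k K] [Algebra K L] {K₀ K₁ : IntermediateField k K} (hle : K₀ ≤ K₁) {x : L}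
    (hx : IsIntegral K₀ x) : IsIntegral K₁ x := by
  obtain ⟨p, hp, hpx⟩ := hx
  exact ⟨p.map (inclusion hle).toRingHom, hp.map _, by rw [eval₂_map]; exact hpx⟩

theorem trdeg_eq_of_isIntegral {k K : Type u} [Field k] [Field K] [Algebra k K]
    {K₀ K₁ : IntermediateField k K} (hle : K₀ ≤ K₁) (hint : ∀ x ∈ K₁, IsIntegral K₀ x) :
    trdeg k K₁ = trdeg k K₀ := by
  let _ : Algebra K₀ K₁ := (inclusion hle).toRingHom.toAlgebra
  have : IsScalarTower k K₀ K₁ := IsScalarTower.of_algebraMap_eq fun _ => rfl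
  have : IsScalarTower K₀ K₁ K := IsScalarTower.of_algebraMap_eq fun _ => rfl
  have : Algebra.IsAlgebraic K₀ K₁ := ⟨fun x => IsIntegral.isAlgebraic <|
    (isIntegral_algHom_iff (IsScalarTower.toAlgHom K₀ K₁ K) (algebraMap K₁ K).injective).1
      (hint x x.2)⟩
  have h := trdeg_add_eq k K₀ (A := K₁)
  rw [trdeg_eq_zero (R := K₀), add_zero] at h
  exact h.symm

theorem exists_descends_trdeg_le {k K L : Type u} [Field k] [Field K] [Field L]
    [Algebra k K] [Algebra K L] [FiniteDimensional K L]
    (E : IntermediateField K L) [Algebra.IsSeparable K E] {K₀ : IntermediateField k K}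
    (h : Descends k L K₀) :
    ∃ K₁ : IntermediateField k K, Descends k E K₁ ∧ trdeg k K₁ = trdeg k K₀ := by
  have hle : K₀ ≤ (algebraicClosure K₀ K).restrictScalars k :=
    fun x hx => (algebraicClosure K₀ K).algebraMap_mem ⟨x, hx⟩
  refine ⟨(algebraicClosure K₀ K).restrictScalars k, ?_, ?_⟩
  · let K₁ := (algebraicClosure K₀ K).restrictScalars k
    change Descends k E K₁
    have hK₁ : ∀ x : K, IsIntegral K₁ x → x ∈ (algebraMap K₁ K).range := by
      intro x hx
      have : IsIntegral K₀ x :=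
        isIntegral_trans (A := algebraicClosure K₀ K) x hx
      exact ⟨⟨x, this⟩, rfl⟩
    have hL : adjoin K {x : L | IsIntegral K₁ x} = ⊤ := by
      refine top_unique (h.adjoin_isIntegral_eq_top.ge.trans (adjoin.mono K _ _ fun x hx => ?_))
      exact isIntegral_of_intermediateField_le hle hx
    have hEM := le_of_forall_isSeparable_mem hL E _
      fun x (hx : x ∈ {x : L | IsSeparable K₁ x}) => subset_adjoin K _ hx
    obtain ⟨b, hb, hbM⟩ := exists_isSeparable_adjoin_simple_eq (F := K₁) (K := K)
      {x : L | IsSeparable K₁ x} fun _ hx => hx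
    rw [← hbM] at hEM
    have : Algebra.IsSeparable K (restrict hEM) :=
      Algebra.IsSeparable.of_algHom _ _ (restrictAlgEquiv hEM).symm.toAlgHom
    have hprim : K⟮AdjoinSimple.gen K b⟯ = ⊤ := by
      apply lift_injective
      simp
    have hgen : IsIntegral K₁ (AdjoinSimple.gen K b) :=
      coe_isIntegral_iff.1 (by simpa using hb.isIntegral)
    exact (descends_of_adjoin_eq_top K₁ hK₁
      (adjoin_isIntegral_eq_of_primitive hgen hprim (restrict hEM))).congr
        (restrictAlgEquiv hEM).symm
  · exact trdeg_eq_of_isIntegral hle fun x hx => hx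

end Descent

/-- For `k ⊆ K ⊆ E ⊆ L` with `[L:K] < ∞` and `E/K` separable,
`ed_k(E/K) ≤ ed_k(L/K)`. -/
theorem statement_4 (k K L : Type u) [Field k] [Field K] [Field L]
    [Algebra k K] [Algebra K L] [FiniteDimensional K L]
    (E : IntermediateField K L) [Algebra.IsSeparable K E] :
    ed k K E ≤ ed k K L := by
  have : Nonempty {K₀ : IntermediateField k K // Descends k L K₀} := ⟨⟨⊤, descends_top k K L⟩⟩
  refine le_ciInf fun ⟨K₀, h⟩ => ?_
  obtain ⟨K₁, h₁, h₂⟩ := exists_descends_trdeg_le E h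
  rw [← h₂]
  exact ciInf_le' (fun K₀ : {K₀ : IntermediateField k K // Descends k E K₀} => trdeg k K₀.1)
    ⟨K₁, h₁⟩
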